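/- Let d ≥ 1 and R > 0, and let v ∈ C²(closure Ω) with Ω = (−R,R)^d satisfy v = 0 on ∂Ω and ∂v/∂z = 0 on ∂Ω \ Γ⁻. Then −2 ∫_Ω v_z Δv dx = ∫_{(−R,R)^{d−1}} |v_z(x′, R)|² dx′ + ∫_{(−R,R)^{d−1}} |v_z(x′, −R)|² dx′; in particular −2 ∫_Ω v_z Δv dx ≥ 0. -/

import Mathlib

open MeasureTheory Real

noncomputable section

/-- The open cube `Ω = (-R, R)^d` (here the dimension is `d + 1 ≥ 1`). -/
def Omega (d : ℕ) (R : ℝ) : Set (EuclideanSpace ℝ (Fin (d + 1))) :=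
  {x | ∀ i, x i ∈ Set.Ioo (-R) R}

/-- The open cube `(-R, R)^{d}` in the hyperplane variables `x'`. -/
def Omega' (d : ℕ) (R : ℝ) : Set (EuclideanSpace ℝ (Fin d)) :=
  {x | ∀ i, x i ∈ Set.Ioo (-R) R}

/-- The bottom face `Γ⁻ = {x ∈ closure Ω : z = -R}`, `z` being the last coordinate. -/
def GammaMinus (d : ℕ) (R : ℝ) : Set (EuclideanSpace ℝ (Fin (d + 1))) :=
  {x | x ∈ closure (Omega d R) ∧ x (Fin.last d) = -R}

/-- Partial derivative with respect to the last coordinate `z`. -/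
def pz (d : ℕ) (u : EuclideanSpace ℝ (Fin (d + 1)) → ℝ)
    (x : EuclideanSpace ℝ (Fin (d + 1))) : ℝ :=
  fderiv ℝ u x (EuclideanSpace.single (Fin.last d) 1)

/-- The Laplacian `Δu = ∑ i, ∂²u/∂xᵢ²`. -/
def lap (d : ℕ) (u : EuclideanSpace ℝ (Fin (d + 1)) → ℝ)
    (x : EuclideanSpace ℝ (Fin (d + 1))) : ℝ :=
  ∑ i : Fin (d + 1),
    fderiv ℝ (fun y => fderiv ℝ u y (EuclideanSpace.single i 1)) x (EuclideanSpace.single i 1)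

/-- The point `(x', t)` of `ℝ^{d+1}` obtained from `x' ∈ ℝ^d` and a last coordinate `t`. -/
def emb (d : ℕ) (x' : EuclideanSpace ℝ (Fin d)) (t : ℝ) : EuclideanSpace ℝ (Fin (d + 1)) :=
  (EuclideanSpace.equiv (Fin (d + 1)) ℝ).symm
    (Fin.snoc (EuclideanSpace.equiv (Fin d) ℝ x') t)

/-- The `i`-th partial derivative. -/
def partialDeriv {n : ℕ} (u : EuclideanSpace ℝ (Fin n) → ℝ) (i : Fin n)
    (x : EuclideanSpace ℝ (Fin n)) : ℝ :=
  fderiv ℝ u x (EuclideanSpace.single i 1)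

lemma contDiff_partialDeriv {n : ℕ} {u : EuclideanSpace ℝ (Fin n) → ℝ} (hu : ContDiff ℝ 2 u)
    (i : Fin n) : ContDiff ℝ 1 (partialDeriv u i) :=
  (hu.fderiv_right (m := 1) (by norm_num)).clm_apply contDiff_const

lemma differentiable_partialDeriv {n : ℕ} {u : EuclideanSpace ℝ (Fin n) → ℝ}
    (hu : ContDiff ℝ 2 u) (i : Fin n) : Differentiable ℝ (partialDeriv u i) :=
  (contDiff_partialDeriv hu i).differentiable (by norm_num)

lemma fderiv_partialDeriv_comm {n : ℕ} {u : EuclideanSpace ℝ (Fin n) → ℝ}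
    (hu : ContDiff ℝ 2 u) (i j : Fin n) (x : EuclideanSpace ℝ (Fin n)) :
    fderiv ℝ (partialDeriv u i) x (EuclideanSpace.single j 1) =
      fderiv ℝ (partialDeriv u j) x (EuclideanSpace.single i 1) := by
  have hd : DifferentiableAt ℝ (fderiv ℝ u) x :=
    ((hu.fderiv_right (m := 1) (by norm_num)).differentiable (by norm_num)) x
  have h (k l : Fin n) : fderiv ℝ (partialDeriv u k) x (EuclideanSpace.single l 1) =
      fderiv ℝ (fderiv ℝ u) x (EuclideanSpace.single l 1) (EuclideanSpace.single k 1) := by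
    have := (hd.hasFDerivAt.clm_apply
      (hasFDerivAt_const (EuclideanSpace.single k (1 : ℝ)) x)).fderiv
    change fderiv ℝ (fun y => fderiv ℝ u y (EuclideanSpace.single k 1)) x _ = _
    rw [this]
    simp
  rw [h, h]
  exact (hu.contDiffAt.isSymmSndFDerivAt (by simp)) _ _

/-- The Rellich-type vector field `2 (∂ₖ u) ∇u - |∇u|² eₖ`. -/
def rellichField {n : ℕ} (u : EuclideanSpace ℝ (Fin n) → ℝ) (k i : Fin n)
    (x : EuclideanSpace ℝ (Fin n)) : ℝ :=
  2 * (partialDeriv u k x * partialDeriv u i x) -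
    if i = k then ∑ j, partialDeriv u j x ^ 2 else 0

lemma contDiff_rellichField {n : ℕ} {u : EuclideanSpace ℝ (Fin n) → ℝ} (hu : ContDiff ℝ 2 u)
    (k i : Fin n) : ContDiff ℝ 1 (rellichField u k i) := by
  unfold rellichField
  have h := contDiff_partialDeriv hu
  split_ifs
  · exact (contDiff_const.mul ((h k).mul (h i))).sub (ContDiff.sum fun j _ => (h j).pow 2)
  · exact (contDiff_const.mul ((h k).mul (h i))).sub contDiff_const

lemma fderiv_rellichField {n : ℕ} {u : EuclideanSpace ℝ (Fin n) → ℝ} (hu : ContDiff ℝ 2 u)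
    (k i : Fin n) (x w : EuclideanSpace ℝ (Fin n)) :
    fderiv ℝ (rellichField u k i) x w =
      2 * (partialDeriv u k x * fderiv ℝ (partialDeriv u i) x w +
        partialDeriv u i x * fderiv ℝ (partialDeriv u k) x w) -
      if i = k then ∑ j, 2 * partialDeriv u j x * fderiv ℝ (partialDeriv u j) x w else 0 := by
  have h (j : Fin n) := (differentiable_partialDeriv hu j x).hasFDerivAt
  have h1 := ((h k).mul (h i)).const_mul (2 : ℝ)
  by_cases hik : i = k
  · have h2 := HasFDerivAt.fun_sum fun j (_ : j ∈ Finset.univ) => (h j).pow 2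
    have hf : rellichField u k i = fun y =>
        2 * (partialDeriv u k * partialDeriv u i) y - ∑ j, partialDeriv u j y ^ 2 := by
      funext y
      simp [rellichField, hik]
    rw [hf, (h1.fun_sub h2).fderiv]
    simp [hik, mul_assoc, mul_add]
  · have hf : rellichField u k i = fun y => 2 * (partialDeriv u k * partialDeriv u i) y := by
      funext y
      simp [rellichField, hik]
    rw [hf, h1.fderiv]
    simp [hik, mul_add]

lemma divergence_rellichField {n : ℕ} {u : EuclideanSpace ℝ (Fin n) → ℝ} (hu : ContDiff ℝ 2 u)
    (k : Fin n) (x : EuclideanSpace ℝ (Fin n)) :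
    ∑ i, fderiv ℝ (rellichField u k i) x (EuclideanSpace.single i 1) =
      2 * (partialDeriv u k x *
        ∑ i, fderiv ℝ (partialDeriv u i) x (EuclideanSpace.single i 1)) := by
  simp only [fderiv_rellichField hu, Finset.sum_sub_distrib, Finset.sum_ite_eq',
    Finset.mem_univ, if_true, mul_add, Finset.sum_add_distrib, Finset.mul_sum]
  rw [add_sub_assoc, add_eq_left, sub_eq_zero]
  refine Finset.sum_congr rfl fun i _ => ?_
  rw [fderiv_partialDeriv_comm hu k i]
  ring

lemma Omega_eq_preimage (d : ℕ) (R : ℝ) :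
    Omega d R = (PiLp.homeomorph 2 fun _ : Fin (d + 1) => ℝ) ⁻¹'
      Set.univ.pi fun _ => Set.Ioo (-R) R := by
  ext x
  simp [Omega, PiLp.homeomorph]

lemma mem_frontier_Omega {d : ℕ} {R : ℝ} (hR : 0 < R) {x : EuclideanSpace ℝ (Fin (d + 1))}
    (hx : ∀ i, x i ∈ Set.Icc (-R) R) {k : Fin (d + 1)} (hk : x k = R ∨ x k = -R) :
    x ∈ frontier (Omega d R) := by
  refine ⟨?_, fun h => ?_⟩
  · rw [Omega_eq_preimage, ← Homeomorph.preimage_closure, closure_pi_set]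
    intro i _
    rw [closure_Ioo (by linarith)]
    exact hx i
  · have := interior_subset h k
    rcases hk with hk | hk <;> simp [hk] at this

lemma partialDeriv_eq_zero_of_eventuallyEq {n : ℕ} {u : EuclideanSpace ℝ (Fin n) → ℝ}
    (hu : Differentiable ℝ u) {i : Fin n} {x : EuclideanSpace ℝ (Fin n)}
    (h : ∀ᶠ t in nhds (0 : ℝ), u (x + t • EuclideanSpace.single i 1) = 0) :
    partialDeriv u i x = 0 := by
  have h1 := ((hu x).hasFDerivAt.hasLineDerivAt (EuclideanSpace.single i (1 : ℝ))).lineDeriv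
  rw [partialDeriv, ← h1, lineDeriv, Filter.EventuallyEq.deriv_eq (f₁ := fun t : ℝ => _)
    (f := fun _ => 0) h, deriv_const]

/-- On the relative interior of a face of the cube, the tangential derivatives of a function
vanishing on the boundary are zero. -/
lemma partialDeriv_eq_zero_of_mem_face {d : ℕ} {R : ℝ} (hR : 0 < R)
    {v : EuclideanSpace ℝ (Fin (d + 1)) → ℝ} (hv : Differentiable ℝ v)
    (hbd : ∀ x ∈ frontier (Omega d R), v x = 0) {x : EuclideanSpace ℝ (Fin (d + 1))}
    {k i : Fin (d + 1)} (hk : x k = R ∨ x k = -R) (hx : ∀ j ≠ k, x j ∈ Set.Ioo (-R) R)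
    (hik : i ≠ k) : partialDeriv v i x = 0 := by
  apply partialDeriv_eq_zero_of_eventuallyEq hv
  have hc : Filter.Tendsto (fun t : ℝ => x i + t) (nhds 0) (nhds (x i)) := by
    have : Continuous fun t : ℝ => x i + t := by fun_prop
    simpa using this.tendsto 0
  filter_upwards [hc (Ioo_mem_nhds (hx i hik).1 (hx i hik).2)] with t ht
  refine hbd _ (mem_frontier_Omega hR (k := k) (fun j => ?_) ?_)
  · by_cases hji : j = i
    · subst hji
      simpa using Set.Ioo_subset_Icc_self ht
    · by_cases hjk : j = k
      · subst hjk
        rcases hk with hk | hk <;> simp [hji, hk] <;> linarith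
      · simpa [hji] using Set.Ioo_subset_Icc_self (hx j hjk)
  · simpa [hik.symm] using hk

lemma setIntegral_cube_eq {n : ℕ} (R : ℝ) (g : EuclideanSpace ℝ (Fin n) → ℝ) :
    ∫ x in {x : EuclideanSpace ℝ (Fin n) | ∀ i, x i ∈ Set.Ioo (-R) R}, g x =
      ∫ y in Set.univ.pi fun _ : Fin n => Set.Ioo (-R) R,
        g ((EuclideanSpace.equiv (Fin n) ℝ).symm y) := by
  rw [← (PiLp.volume_preserving_toLp (Fin n)).setIntegral_preimage_emb
    (MeasurableEquiv.toLp 2 (Fin n → ℝ)).measurableEmbedding]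
  congr 2
  ext y
  simp

lemma setIntegral_Icc_eq {n : ℕ} (R : ℝ) (g : (Fin n → ℝ) → ℝ) :
    ∫ y in Set.Icc (fun _ : Fin n => -R) (fun _ => R), g y =
      ∫ y in Set.univ.pi fun _ : Fin n => Set.Ioo (-R) R, g y :=
  (setIntegral_congr_set (Measure.univ_pi_Ioo_ae_eq_Icc
    (f := fun _ : Fin n => -R) (g := fun _ => R))).symm

lemma measurableSet_pi_Ioo (n : ℕ) (R : ℝ) :
    MeasurableSet (Set.univ.pi fun _ : Fin n => Set.Ioo (-R) R) :=
  MeasurableSet.univ_pi fun _ => measurableSet_Ioo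

/-- The divergence theorem on the cube `(-R, R)^{d+1}` for a `C¹` vector field. -/
lemma integral_divergence_Omega {d : ℕ} {R : ℝ} (hR : 0 < R)
    {F : Fin (d + 1) → EuclideanSpace ℝ (Fin (d + 1)) → ℝ} (hF : ∀ i, ContDiff ℝ 1 (F i)) :
    ∫ x in Omega d R, ∑ i, fderiv ℝ (F i) x (EuclideanSpace.single i 1) =
      ∑ i : Fin (d + 1),
        ((∫ y in Set.univ.pi fun _ : Fin d => Set.Ioo (-R) R,
            F i ((EuclideanSpace.equiv (Fin (d + 1)) ℝ).symm (i.insertNth R y))) -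
          ∫ y in Set.univ.pi fun _ : Fin d => Set.Ioo (-R) R,
            F i ((EuclideanSpace.equiv (Fin (d + 1)) ℝ).symm (i.insertNth (-R) y))) := by
  let L := (EuclideanSpace.equiv (Fin (d + 1)) ℝ).symm
  have hL (i : Fin (d + 1)) : L (Pi.single i 1) = EuclideanSpace.single i 1 := by
    ext j
    simp [L]
  have key := integral_divergence_of_hasFDerivAt_off_countable'
    (fun _ : Fin (d + 1) => -R) (fun _ => R) (fun _ => by linarith)
    (fun i y => F i (L y))
    (fun i y => (fderiv ℝ (F i) (L y)).comp (L : (Fin (d + 1) → ℝ) →L[ℝ] _))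
    ∅ Set.countable_empty
    (fun i => ((hF i).continuous.comp L.continuous).continuousOn)
    (fun y _ i => (((hF i).differentiable (by norm_num) (L y)).hasFDerivAt).comp y
      L.hasFDerivAt)
    (by
      refine ContinuousOn.integrableOn_Icc (Continuous.continuousOn ?_)
      refine continuous_finsetSum _ fun i _ => ?_
      exact ((((hF i).continuous_fderiv (by norm_num)).comp L.continuous).clm_comp
        continuous_const).clm_apply continuous_const)
  rw [Omega, setIntegral_cube_eq, ← setIntegral_Icc_eq]
  simp only [ContinuousLinearMap.comp_apply, ContinuousLinearEquiv.coe_coe, hL] at key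
  refine key.trans (Finset.sum_congr rfl fun i _ => ?_)
  exact congrArg₂ _ (setIntegral_Icc_eq R _) (setIntegral_Icc_eq R _)

lemma emb_equiv_symm (d : ℕ) (y : Fin d → ℝ) (c : ℝ) :
    emb d ((EuclideanSpace.equiv (Fin d) ℝ).symm y) c =
      (EuclideanSpace.equiv (Fin (d + 1)) ℝ).symm ((Fin.last d).insertNth c y) := by
  rw [emb, ContinuousLinearEquiv.apply_symm_apply, Fin.insertNth_last']

/-- integration-by-parts identity for `-2 ∫_Ω v_z Δv`. -/
theorem integration_by_parts_identity (d : ℕ) (R : ℝ) (hR : 0 < R)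
    (v : EuclideanSpace ℝ (Fin (d + 1)) → ℝ) (hv : ContDiff ℝ 2 v)
    (hbd : ∀ x ∈ frontier (Omega d R), v x = 0)
    (hbd' : ∀ x ∈ frontier (Omega d R) \ GammaMinus d R, pz d v x = 0) :
    (-2 * ∫ x in Omega d R, pz d v x * lap d v x) =
        (∫ x' in Omega' d R, (pz d v (emb d x' R)) ^ 2) +
          (∫ x' in Omega' d R, (pz d v (emb d x' (-R))) ^ 2) ∧
      0 ≤ -2 * ∫ x in Omega d R, pz d v x * lap d v x := by
  have hvd : Differentiable ℝ v := hv.differentiable (by norm_num)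
  let L := (EuclideanSpace.equiv (Fin (d + 1)) ℝ).symm
  let S : Set (Fin d → ℝ) := Set.univ.pi fun _ => Set.Ioo (-R) R
  have hcoord (i : Fin (d + 1)) (c : ℝ) (y : Fin d → ℝ) (hy : y ∈ S) :
      L (i.insertNth c y) i = c ∧ ∀ j ≠ i, L (i.insertNth c y) j ∈ Set.Ioo (-R) R := by
    refine ⟨by simp [L], fun j hj => ?_⟩
    obtain ⟨m, rfl⟩ := Fin.exists_succAbove_eq hj
    simpa [L] using hy m trivial
  have hfr (i : Fin (d + 1)) (c : ℝ) (hc : c = R ∨ c = -R) (y : Fin d → ℝ) (hy : y ∈ S) :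
      L (i.insertNth c y) ∈ frontier (Omega d R) := by
    obtain ⟨h1, h2⟩ := hcoord i c y hy
    refine mem_frontier_Omega hR (k := i) (fun j => ?_) (by rwa [h1])
    by_cases hj : j = i
    · subst hj
      rw [h1]
      rcases hc with rfl | rfl <;> constructor <;> linarith
    · exact Set.Ioo_subset_Icc_self (h2 j hj)
  have hside (i : Fin (d + 1)) (hi : i ≠ Fin.last d) (c : ℝ) (hc : c = R ∨ c = -R) :
      ∫ y in S, rellichField v (Fin.last d) i (L (i.insertNth c y)) = 0 := by
    refine setIntegral_eq_zero_of_forall_eq_zero fun y hy => ?_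
    have h0 : partialDeriv v (Fin.last d) (L (i.insertNth c y)) = 0 :=
      hbd' _ ⟨hfr i c hc y hy, fun h =>
        ((hcoord i c y hy).2 _ hi.symm).1.ne' h.2⟩
    simp [rellichField, hi, h0]
  have hend (c : ℝ) (hc : c = R ∨ c = -R) :
      ∫ y in S, rellichField v (Fin.last d) (Fin.last d) (L ((Fin.last d).insertNth c y)) =
        ∫ x' in Omega' d R, (pz d v (emb d x' c)) ^ 2 := by
    rw [Omega', setIntegral_cube_eq]
    refine setIntegral_congr_fun (measurableSet_pi_Ioo d R) fun y hy => ?_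
    obtain ⟨h1, h2⟩ := hcoord (Fin.last d) c y hy
    have ht (j : Fin (d + 1)) (hj : j ≠ Fin.last d) :=
      partialDeriv_eq_zero_of_mem_face hR hvd hbd (by rwa [h1]) h2 hj
    have hemb := emb_equiv_symm d y c
    simp only [hemb, rellichField, if_true]
    rw [Finset.sum_eq_single (Fin.last d) (fun j _ hj => by rw [ht j hj]; simp) (by simp)]
    change 2 * (pz d v _ * pz d v _) - pz d v _ ^ 2 = _
    ring
  have htop : ∫ x' in Omega' d R, (pz d v (emb d x' R)) ^ 2 = 0 := by
    rw [Omega', setIntegral_cube_eq]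
    refine setIntegral_eq_zero_of_forall_eq_zero fun y hy => ?_
    have hemb := emb_equiv_symm d y R
    rw [hemb, hbd' _ ⟨hfr _ R (.inl rfl) y hy, fun h => ?_⟩]
    · simp
    · have := h.2
      rw [(hcoord _ R y hy).1] at this
      linarith
  have hdiv := integral_divergence_Omega hR (contDiff_rellichField hv (Fin.last d))
  simp only [divergence_rellichField hv] at hdiv
  rw [integral_const_mul, Finset.sum_eq_single (Fin.last d)
    (fun i _ hi => by
      exact (congrArg₂ _ (hside i hi R (.inl rfl)) (hside i hi (-R) (.inr rfl))).trans
        (sub_self 0)) (by simp)] at hdiv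
  have hmain := hdiv.trans (congrArg₂ _ (hend R (.inl rfl)) (hend (-R) (.inr rfl)))
  change 2 * (∫ x in Omega d R, pz d v x * lap d v x) = _ at hmain
  have hnonneg : 0 ≤ ∫ x' in Omega' d R, (pz d v (emb d x' (-R))) ^ 2 :=
    integral_nonneg fun _ => sq_nonneg _
  rw [htop] at hmain ⊢
  constructor <;> linarith
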